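/- Let (𝒜, ℬ) be a complete hereditary cotorsion pair in a Grothendieck category G. Then the following are equivalent: (i) a complex Y with components in ℬ satisfies Ext^1_{Ch(G)}(X, Y) = 0 for all X ∈ ℬ~ if and only if all components of Y are injective (ℬ~^⊥ ∩ dwℬ = dwInj); (ii) Ext^1_{Ch(G)}(X, I) = 0 for every X ∈ ℬ~ and every complex I with injective components (ℬ~ ⊆ ^⊥dwInj). -/

import Mathlib

open CategoryTheory CategoryTheory.Limits CategoryTheory.Abelian ZeroObject

universe w' w v u

/-- There is a short exact sequence `0 → X → Y → Z → 0` in the abelian category `C`. -/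
def IsShortExactSeq {C : Type u} [Category.{v} C] [Abelian C] (X Y Z : C) : Prop :=
  ∃ (f : X ⟶ Y) (g : Y ⟶ Z) (w : f ≫ g = 0), (ShortComplex.mk f g w).ShortExact

/-- `(𝒜, ℬ)` is a cotorsion pair in the abelian category `C`:
each class is the `Ext¹`-orthogonal of the other. -/
structure IsCotorsionPair (C : Type u) [Category.{v} C] [Abelian C] [HasExt.{w} C]
    (𝒜 ℬ : Set C) : Prop where
  mem_left_iff : ∀ X : C, X ∈ 𝒜 ↔ ∀ B ∈ ℬ, Subsingleton (Abelian.Ext.{w} X B 1)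
  mem_right_iff : ∀ Y : C, Y ∈ ℬ ↔ ∀ A ∈ 𝒜, Subsingleton (Abelian.Ext.{w} A Y 1)

/-- `(𝒜, ℬ)` is a complete cotorsion pair: every object has a special `ℬ`-preenvelope
`0 → M → B → A → 0` and a special `𝒜`-precover `0 → B' → A' → M → 0`. -/
structure IsCompleteCotorsionPair (C : Type u) [Category.{v} C] [Abelian C] [HasExt.{w} C]
    (𝒜 ℬ : Set C) extends IsCotorsionPair C 𝒜 ℬ : Prop where
  preenvelope : ∀ M : C, ∃ B A, B ∈ ℬ ∧ A ∈ 𝒜 ∧ IsShortExactSeq M B A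
  precover : ∀ M : C, ∃ B A, B ∈ ℬ ∧ A ∈ 𝒜 ∧ IsShortExactSeq B A M

/-- `(𝒜, ℬ)` is a complete hereditary cotorsion pair:
moreover `Ext^i(A, B) = 0` for all `A ∈ 𝒜`, `B ∈ ℬ` and `i ≥ 1`. -/
structure IsCompleteHereditaryCotorsionPair (C : Type u) [Category.{v} C] [Abelian C]
    [HasExt.{w} C] (𝒜 ℬ : Set C) extends IsCompleteCotorsionPair C 𝒜 ℬ : Prop where
  hereditary : ∀ A ∈ 𝒜, ∀ B ∈ ℬ, ∀ i : ℕ, 1 ≤ i → Subsingleton (Abelian.Ext.{w} A B i)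

namespace HomologicalComplex

variable {C : Type*} [Category* C] [Abelian C] {ι : Type*} {c : ComplexShape ι} {i j : ι}
  (hij : c.Rel i j)

/-- The morphism between disk complexes induced by a morphism in `C`. -/
noncomputable def diskMap (h : i ≠ j) {X Y : C} (f : X ⟶ Y) :
    double (𝟙 X) hij ⟶ double (𝟙 Y) hij :=
  mkHomFromDouble hij h (f ≫ (doubleXIso₀ _ hij).inv) (f ≫ (doubleXIso₁ _ hij h).inv)
    (by simp [double_d _ hij h]) (fun k _ ↦ by simp [double_d_eq_zero₀ _ hij j k h.symm])

lemma doubleXIso₀_inv_diskMap_f (h : i ≠ j) {X Y : C} (f : X ⟶ Y) :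
    (doubleXIso₀ (𝟙 X) hij).inv ≫ (diskMap hij h f).f i =
      f ≫ (doubleXIso₀ (𝟙 Y) hij).inv := by
  simp [diskMap]

lemma doubleXIso₁_inv_diskMap_f (h : i ≠ j) {X Y : C} (f : X ⟶ Y) :
    (doubleXIso₁ (𝟙 X) hij h).inv ≫ (diskMap hij h f).f j =
      f ≫ (doubleXIso₁ (𝟙 Y) hij h).inv := by
  simp [diskMap]

lemma diskMap_comp_eq_zero (h : i ≠ j) {X Y Z : C} (f : X ⟶ Y) (g : Y ⟶ Z) (w : f ≫ g = 0) :
    diskMap hij h f ≫ diskMap hij h g = 0 := by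
  apply from_double_hom_ext <;> simp [diskMap, ← Category.assoc f g, w]

lemma shortExact_diskMap (h : i ≠ j) {S : ShortComplex C} (hS : S.ShortExact) :
    (ShortComplex.mk (diskMap hij h S.f) (diskMap hij h S.g)
      (diskMap_comp_eq_zero hij h _ _ S.zero)).ShortExact := by
  apply shortExact_of_degreewise_shortExact
  intro k
  by_cases h₀ : k = i
  · subst h₀
    exact ShortComplex.shortExact_of_iso (ShortComplex.isoMk
      (doubleXIso₀ (𝟙 S.X₁) hij).symm (doubleXIso₀ (𝟙 S.X₂) hij).symm
      (doubleXIso₀ (𝟙 S.X₃) hij).symm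
      (doubleXIso₀_inv_diskMap_f hij h S.f) (doubleXIso₀_inv_diskMap_f hij h S.g)) hS
  by_cases h₁ : k = j
  · subst h₁
    exact ShortComplex.shortExact_of_iso (ShortComplex.isoMk
      (doubleXIso₁ (𝟙 S.X₁) hij h).symm (doubleXIso₁ (𝟙 S.X₂) hij h).symm
      (doubleXIso₁ (𝟙 S.X₃) hij h).symm
      (doubleXIso₁_inv_diskMap_f hij h S.f) (doubleXIso₁_inv_diskMap_f hij h S.g)) hS
  · have hz (X : C) : IsZero ((double (𝟙 X) hij).X k) := isZero_double_X _ hij k h₀ h₁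
    exact
      { exact := ShortComplex.exact_of_isZero_X₂ _ (hz _)
        mono_f := ⟨fun _ _ _ ↦ (hz _).eq_of_tgt _ _⟩
        epi_g := ⟨fun _ _ _ ↦ (hz _).eq_of_src _ _⟩ }

lemma isIso_double_id_d (h : i ≠ j) (X : C) : IsIso ((double (𝟙 X) hij).d i j) := by
  rw [double_d _ hij h]
  infer_instance

lemma exactAt_double_id (h : i ≠ j) (X : C) (k : ι) : (double (𝟙 X) hij).ExactAt k := by
  by_cases h₀ : k = i
  · subst h₀
    rw [exactAt_iff' _ _ k j rfl (c.next_eq' hij),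
      ShortComplex.exact_iff_mono _ (double_d_eq_zero₁ _ hij _ _ h)]
    have := isIso_double_id_d hij h X
    exact inferInstanceAs (Mono ((double (𝟙 X) hij).d k j))
  by_cases h₁ : k = j
  · subst h₁
    rw [exactAt_iff' _ i k _ (c.prev_eq' hij) rfl,
      ShortComplex.exact_iff_epi _ (double_d_eq_zero₀ _ hij _ _ h.symm)]
    have := isIso_double_id_d hij h X
    exact inferInstanceAs (Epi ((double (𝟙 X) hij).d i k))
  · exact ShortComplex.exact_of_isZero_X₂ _ (isZero_double_X (𝟙 X) hij k h₀ h₁)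

/-- Every cycle object of a disk complex is either zero or the object defining the disk. -/
lemma cycles_double_id (h : i ≠ j) (X : C) (k : ι) :
    IsZero ((double (𝟙 X) hij).cycles k) ∨ Nonempty ((double (𝟙 X) hij).cycles k ≅ X) := by
  by_cases h₁ : k = j
  · subst h₁
    exact Or.inr ⟨iCyclesIso _ k _ rfl (double_d_eq_zero₀ _ hij _ _ h.symm) ≪≫
      doubleXIso₁ _ hij h⟩
  left
  apply IsZero.of_mono_eq_zero ((double (𝟙 X) hij).iCycles k)
  by_cases h₀ : k = i
  · subst h₀
    have := isIso_double_id_d hij h X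
    rw [← cancel_mono ((double (𝟙 X) hij).d k j), iCycles_d, zero_comp]
  · exact (isZero_double_X _ hij k h₀ h₁).eq_of_tgt _ _

/-- Every object of a disk complex is either zero or the object defining the disk. -/
lemma X_double_id (X : C) (k : ι) :
    IsZero ((double (𝟙 X) hij).X k) ∨ Nonempty ((double (𝟙 X) hij).X k ≅ X) := by
  by_cases h₀ : k = i
  · subst h₀
    exact Or.inr ⟨doubleXIso₀ _ hij⟩
  by_cases h₁ : k = j
  · subst h₁
    exact Or.inr ⟨doubleXIso₁ _ hij (Ne.symm h₀)⟩
  · exact Or.inl (isZero_double_X _ hij k h₀ h₁)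

/-- If `Ext¹` from the disk on `S.X₃` to `K` vanishes, then morphisms `S.X₁ ⟶ K.X i` extend
along `S.f`. -/
lemma exists_extension_of_subsingleton_ext_disk (h : i ≠ j)
    [HasExt.{w} (HomologicalComplex C c)] {S : ShortComplex C} (hS : S.ShortExact)
    (K : HomologicalComplex C c)
    [hK : Subsingleton (Ext.{w} (double (𝟙 S.X₃) hij) K 1)] (φ : S.X₁ ⟶ K.X i) :
    ∃ ψ : S.X₂ ⟶ K.X i, S.f ≫ ψ = φ := by
  let Φ : double (𝟙 S.X₁) hij ⟶ K :=
    mkHomFromDouble hij h φ (φ ≫ K.d i j) (by simp) (by simp)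
  obtain ⟨x, hx⟩ := Ext.contravariant_sequence_exact₁ (shortExact_diskMap hij h hS) K
    (Ext.mk₀ Φ) (n₁ := 1) rfl (hK.elim _ _)
  obtain ⟨Ψ, rfl⟩ := Ext.addEquiv₀.symm.surjective x
  have hΨ : diskMap hij h S.f ≫ Ψ = Φ := by
    apply (Ext.mk₀_bijective _ _).1
    simpa using hx
  refine ⟨(doubleXIso₀ _ hij).inv ≫ Ψ.f i, ?_⟩
  have := congr_arg (fun α ↦ (doubleXIso₀ _ hij).inv ≫ α.f i) hΨ
  simpa [diskMap, Φ] using this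

end HomologicalComplex

namespace IsCotorsionPair

variable {C : Type u} [Category.{v} C] [Abelian C] [HasExt.{w} C] {𝒜 ℬ : Set C}

lemma mem_right_of_injective (hcp : IsCotorsionPair C 𝒜 ℬ) (I : C) [Injective I] : I ∈ ℬ :=
  (hcp.mem_right_iff I).2 fun _ _ ↦ Ext.subsingleton_of_injective _ _ 0

lemma mem_right_of_iso (hcp : IsCotorsionPair C 𝒜 ℬ) {X Y : C} (e : X ≅ Y) (hX : X ∈ ℬ) :
    Y ∈ ℬ := by
  refine (hcp.mem_right_iff Y).2 fun A hA ↦ subsingleton_of_forall_eq 0 fun x ↦ ?_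
  have := (hcp.mem_right_iff X).1 hX A hA
  have hx : x.comp (Ext.mk₀ e.inv) (add_zero 1) = 0 := Subsingleton.elim _ _
  simpa using congr_arg (fun y ↦ y.comp (Ext.mk₀ e.hom) (add_zero 1)) hx

lemma mem_right_of_isZero_or_iso (hcp : IsCotorsionPair C 𝒜 ℬ) {X Y : C} (hX : X ∈ ℬ)
    (h : IsZero Y ∨ Nonempty (Y ≅ X)) : Y ∈ ℬ := by
  obtain h | ⟨⟨e⟩⟩ := h
  · have : Injective Y := h.injective
    exact hcp.mem_right_of_injective Y
  · exact hcp.mem_right_of_iso e.symm hX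

end IsCotorsionPair

namespace IsCompleteHereditaryCotorsionPair

variable {C : Type u} [Category.{v} C] [Abelian C] [HasExt.{w} C] {𝒜 ℬ : Set C}

/-- The right class of a hereditary cotorsion pair is closed under cokernels of monomorphisms. -/
lemma mem_right_of_shortExact (hcp : IsCompleteHereditaryCotorsionPair C 𝒜 ℬ)
    {S : ShortComplex C} (hS : S.ShortExact) (h₁ : S.X₁ ∈ ℬ) (h₂ : S.X₂ ∈ ℬ) : S.X₃ ∈ ℬ := by
  refine (hcp.mem_right_iff _).2 fun A hA ↦ subsingleton_of_forall_eq 0 fun x ↦ ?_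
  have := hcp.hereditary A hA _ h₁ 2 (by lia)
  have := hcp.hereditary A hA _ h₂ 1 le_rfl
  obtain ⟨y, rfl⟩ := Ext.covariant_sequence_exact₃ A hS x rfl (Subsingleton.elim _ _)
  rw [Subsingleton.elim y 0, Ext.zero_comp]

end IsCompleteHereditaryCotorsionPair

/-- for a complete hereditary cotorsion pair `(𝒜, ℬ)` in a Grothendieck
category, `ℬ~^⊥ ∩ dwℬ = dwInj` if and only if `ℬ~ ⊆ ^⊥dwInj`. -/
theorem stmt14 (C : Type u) [Category.{v} C] [Abelian C]
    [HasFilteredColimits C] [AB5 C] [HasSeparator C]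
    [HasExt.{w} C] [HasExt.{w'} (CochainComplex C ℤ)]
    (𝒜 ℬ : Set C) (hcp : IsCompleteHereditaryCotorsionPair C 𝒜 ℬ) :
    -- (i) a complex `Y ∈ dwℬ` is right `Ext¹`-orthogonal to `ℬ~` iff its components are
    -- injective ...
    (∀ Y : CochainComplex C ℤ, (∀ n : ℤ, Y.X n ∈ ℬ) →
      ((∀ X : CochainComplex C ℤ, (∀ n : ℤ, X.ExactAt n) → (∀ n : ℤ, X.X n ∈ ℬ) →
        (∀ n : ℤ, X.cycles n ∈ ℬ) → Subsingleton (Abelian.Ext.{w'} X Y 1)) ↔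
        ∀ n : ℤ, Injective (Y.X n))) ↔
    -- ... iff (ii) `Ext¹(X, I) = 0` for every `X ∈ ℬ~` and every complex `I` with injective
    -- components:
    (∀ X : CochainComplex C ℤ, (∀ n : ℤ, X.ExactAt n) → (∀ n : ℤ, X.X n ∈ ℬ) →
      (∀ n : ℤ, X.cycles n ∈ ℬ) →
      ∀ I : CochainComplex C ℤ, (∀ n : ℤ, Injective (I.X n)) →
        Subsingleton (Abelian.Ext.{w'} X I 1)) := by
  constructor
  · intro hi X hX hX' hX'' I hI
    have hIB (n : ℤ) : I.X n ∈ ℬ := hcp.mem_right_of_injective _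
    exact (hi I hIB).2 hI X hX hX' hX''
  · intro hii Y hY
    refine ⟨fun hY' n ↦ ?_, fun hY' X hX hX' hX'' ↦ hii X hX hX' hX'' Y hY'⟩
    have : IsGrothendieckAbelian.{v} C := {}
    let S : ShortComplex C := .mk (Injective.ι (Y.X n)) (cokernel.π _) (cokernel.condition _)
    have hS : S.ShortExact :=
      { exact := ShortComplex.exact_cokernel _
        mono_f := inferInstanceAs (Mono (Injective.ι (Y.X n)))
        epi_g := inferInstanceAs (Epi (cokernel.π _)) }
    have hQ : S.X₃ ∈ ℬ := hcp.mem_right_of_shortExact hS (hY n)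
      (hcp.mem_right_of_injective (Injective.under (Y.X n)))
    have hn : (ComplexShape.up ℤ).Rel n (n + 1) := rfl
    have := hY' (HomologicalComplex.double (𝟙 S.X₃) hn)
      (HomologicalComplex.exactAt_double_id hn (by lia) _)
      (fun k ↦ hcp.mem_right_of_isZero_or_iso hQ (HomologicalComplex.X_double_id hn _ k))
      (fun k ↦ hcp.mem_right_of_isZero_or_iso hQ
        (HomologicalComplex.cycles_double_id hn (by lia) _ k))
    obtain ⟨ψ, hψ⟩ := HomologicalComplex.exists_extension_of_subsingleton_ext_disk hn (by lia)
      hS Y (𝟙 (Y.X n))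
    exact Retract.injective (Y := Injective.under (Y.X n)) ⟨S.f, ψ, hψ⟩
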